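/- Let r > 0 and 0 < α ≤ r, set θ₀ = arccos(α/(2r)) − π/3 (note θ₀ ≥ 0 since α ≤ r), and let v, c, u be points of the Euclidean plane with dist(v,c) = r, dist(v,u) = α, and the angle at v between the rays from v to c and from v to u equal to θ₀. Then the Lebesgue area of the region (D(v,α) ∩ D(u,α)) \ D(c,r) — where D(x,ρ) denotes the open ball of radius ρ centered at x — equals (α²/2)·(π/3 − √3/2) − r²·arcsin(α/(2r)) + (r·α/2)·√(1 − α²/(4r²)). -/

import Mathlib

open Real MeasureTheory Metric

/-- The area between two polar curves `ρ = f φ` and `ρ = g φ` over an interval of angles. -/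
theorem volume_eq_ofReal_integral_of_polar {S : Set (ℝ × ℝ)} (hS : MeasurableSet S)
    {f g : ℝ → ℝ} (hf : Continuous f) (hg : Continuous g) {a b : ℝ} (hab : a ≤ b)
    (ha : -π ≤ a) (hb : b ≤ π) (hf0 : ∀ φ ∈ Set.Ioo a b, 0 ≤ f φ)
    (hfg : ∀ φ ∈ Set.Ioo a b, f φ ≤ g φ)
    (hmem : ∀ ρ φ : ℝ, 0 < ρ → φ ∈ Set.Ioo (-π) π →
      ((ρ * cos φ, ρ * sin φ) ∈ S ↔ φ ∈ Set.Ioo a b ∧ ρ ∈ Set.Ico (f φ) (g φ))) :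
    volume S = ENNReal.ofReal (∫ φ in a..b, (g φ ^ 2 - f φ ^ 2) / 2) := by
  have inner_eq : ∀ φ ∈ Set.Ioo a b,
      ∫⁻ ρ in Set.Ioi (0 : ℝ), (Set.Ico (f φ) (g φ)).indicator ENNReal.ofReal ρ =
        ENNReal.ofReal ((g φ ^ 2 - f φ ^ 2) / 2) := by
    intro φ hφ
    have h0 := hf0 φ hφ
    rw [lintegral_indicator measurableSet_Ico, Measure.restrict_restrict measurableSet_Ico]
    have hae : (Set.Ico (f φ) (g φ) ∩ Set.Ioi 0 : Set ℝ) =ᵐ[volume] Set.Ioc (f φ) (g φ) := by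
      refine (Ico_ae_eq_Ioc.inter (Ioi_ae_eq_Ici (a := (0 : ℝ)))).trans ?_
      have hsub : Set.Ioc (f φ) (g φ) ⊆ Set.Ici 0 := fun x hx => h0.trans hx.1.le
      rw [Set.inter_eq_left.mpr hsub]
      exact Filter.EventuallyEq.rfl
    rw [setLIntegral_congr hae, ← ofReal_integral_eq_lintegral_ofReal,
      ← intervalIntegral.integral_of_le (hfg φ hφ), integral_id]
    · exact continuous_id.integrableOn_Ioc
    · filter_upwards [ae_restrict_mem measurableSet_Ioc] with x hx
      exact h0.trans hx.1.le
  calc volume S = ∫⁻ p, S.indicator 1 p := (lintegral_indicator_one hS).symm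
    _ = ∫⁻ p in polarCoord.target,
          ENNReal.ofReal p.1 • S.indicator (1 : ℝ × ℝ → ENNReal) (polarCoord.symm p) :=
        (lintegral_comp_polarCoord_symm _).symm
    _ = ∫⁻ φ in Set.Ioo (-π) π, ∫⁻ ρ in Set.Ioi (0 : ℝ),
          ENNReal.ofReal ρ • S.indicator (1 : ℝ × ℝ → ENNReal) (polarCoord.symm (ρ, φ)) := by
        rw [polarCoord_target, Measure.volume_eq_prod, ← Measure.prod_restrict,
          lintegral_prod_symm']
        have hind : Measurable (S.indicator (1 : ℝ × ℝ → ENNReal)) :=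
          measurable_one.indicator hS
        exact (ENNReal.measurable_ofReal.comp measurable_fst).smul
          (hind.comp continuous_polarCoord_symm.measurable)
    _ = ∫⁻ φ in Set.Ioo (-π) π, (Set.Ioo a b).indicator
          (fun φ => ENNReal.ofReal ((g φ ^ 2 - f φ ^ 2) / 2)) φ := by
        refine setLIntegral_congr_fun measurableSet_Ioo fun φ hφ => ?_
        by_cases h : φ ∈ Set.Ioo a b
        · simp only [Set.indicator_of_mem h]
          rw [← inner_eq φ h]
          refine setLIntegral_congr_fun measurableSet_Ioi fun ρ hρ => ?_
          have := hmem ρ φ hρ hφ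
          by_cases h' : ρ ∈ Set.Ico (f φ) (g φ)
          · simp [Set.indicator, polarCoord_symm_apply, this.mpr ⟨h, h'⟩, h'.1, h'.2]
          · have h2 : (ρ * cos φ, ρ * sin φ) ∉ S := fun hh => h' (this.mp hh).2
            rw [Set.indicator_of_notMem h', polarCoord_symm_apply, Set.indicator_of_notMem h2]
            simp
        · simp only [Set.indicator_of_notMem h]
          rw [setLIntegral_congr_fun (g := 0) measurableSet_Ioi, Pi.zero_def, lintegral_zero]
          intro ρ hρ
          have h2 : (ρ * cos φ, ρ * sin φ) ∉ S := fun hh => h ((hmem ρ φ hρ hφ).mp hh).1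
          simp [polarCoord_symm_apply, Set.indicator_of_notMem h2]
    _ = ∫⁻ φ in Set.Ioo a b, ENNReal.ofReal ((g φ ^ 2 - f φ ^ 2) / 2) := by
        rw [lintegral_indicator measurableSet_Ioo, Measure.restrict_restrict measurableSet_Ioo,
          Set.inter_eq_left.mpr (Set.Ioo_subset_Ioo ha hb)]
    _ = _ := by
        rw [intervalIntegral.integral_of_le hab, integral_Ioc_eq_integral_Ioo,
          ofReal_integral_eq_lintegral_ofReal]
        · exact ((((hg.pow 2).sub (hf.pow 2)).div_const 2).integrableOn_Icc).mono_set
            Set.Ioo_subset_Icc_self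
        · filter_upwards [ae_restrict_mem measurableSet_Ioo] with φ hφ
          have h1 := hf0 φ hφ
          have h2 := hfg φ hφ
          have : f φ ^ 2 ≤ g φ ^ 2 := pow_le_pow_left₀ h1 h2 2
          simp only [Pi.zero_apply]
          linarith

/-- An orthonormal basis of the plane whose first vector is `e` and in which `w` has a nonnegative
second coordinate. -/
theorem exists_orthonormalBasis_adapted (e w : EuclideanSpace ℝ (Fin 2)) (he : ‖e‖ = 1) :
    ∃ b : OrthonormalBasis (Fin 2) ℝ (EuclideanSpace ℝ (Fin 2)), b 0 = e ∧ 0 ≤ b.repr w 1 := by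
  have hv : Orthonormal ℝ (({0} : Set (Fin 2)).domRestrict
      (fun _ => e : Fin 2 → EuclideanSpace ℝ (Fin 2))) := by
    refine ⟨fun _ => he, fun i j hij => ?_⟩
    exact absurd (Subsingleton.elim i j) hij
  obtain ⟨b, hb⟩ := hv.exists_orthonormalBasis_extension_of_card_eq (by simp)
  have hb0 : b 0 = e := hb 0 rfl
  by_cases hw : 0 ≤ b.repr w 1
  · exact ⟨b, hb0, hw⟩
  · have hv' : Orthonormal ℝ ((Set.univ : Set (Fin 2)).domRestrict ![b 0, -b 1]) := by
      have : Orthonormal ℝ ![b 0, -b 1] := by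
        have h1 : inner ℝ (b 0) (b 1) = 0 := b.orthonormal.2 (by decide)
        have h2 : inner ℝ (b 1) (b 0) = 0 := b.orthonormal.2 (by decide)
        refine ⟨fun i => ?_, fun i j hij => ?_⟩
        · fin_cases i <;> simp
        · fin_cases i <;> fin_cases j <;> simp_all
      exact this.comp _ Subtype.val_injective
    obtain ⟨b', hb'⟩ := hv'.exists_orthonormalBasis_extension_of_card_eq (by simp)
    refine ⟨b', by rw [hb' 0 trivial, ← hb0]; rfl, ?_⟩
    rw [OrthonormalBasis.repr_apply_apply] at hw ⊢
    rw [hb' 1 trivial]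
    simp only [Matrix.cons_val_one, Matrix.cons_val_fin_one, inner_neg_left]
    linarith

/-- In polar coordinates around `v`, the lune is the region between the circle around `c` and the
circle around `u`, over angles between `θ + π / 3` and `θ + π / 2`. -/
theorem lune_polar_iff {r α θ : ℝ} (hα : 0 < α) (hαr : α ≤ r)
    (hθ0 : 0 ≤ θ) (hθ : θ < π / 6) (hcos : cos (θ + π / 3) = α / (2 * r))
    {ρ φ : ℝ} (hρ : 0 < ρ) (hφ : φ ∈ Set.Ioo (-π) π) :
    (ρ < α ∧ ρ < 2 * α * cos (φ - θ) ∧ 2 * r * cos φ ≤ ρ) ↔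
      φ ∈ Set.Ioo (θ + π / 3) (θ + π / 2) ∧
        ρ ∈ Set.Ico (2 * r * max 0 (cos φ)) (2 * α * cos (φ - θ)) := by
  have hr : 0 < r := hα.trans_le hαr
  have hpi := pi_pos
  have hαcos : α = 2 * r * cos (θ + π / 3) := by rw [hcos]; field_simp
  constructor
  · rintro ⟨h1, h2, h3⟩
    have hc : 0 < cos (φ - θ) := by
      by_contra! h
      nlinarith
    have hle : θ + π / 3 < φ := by
      by_contra! h
      by_cases h4 : -(θ + π / 3) ≤ φ
      · have : cos (θ + π / 3) ≤ cos φ := by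
          rw [← cos_abs φ]
          exact cos_le_cos_of_nonneg_of_le_pi (abs_nonneg _) (by linarith) (abs_le.mpr ⟨h4, h⟩)
        nlinarith
      · push Not at h4
        by_cases h5 : -(π / 2) ≤ φ - θ
        · have : cos (φ - θ) ≤ cos φ := by
            rw [← cos_neg φ, ← cos_neg (φ - θ)]
            exact cos_le_cos_of_nonneg_of_le_pi (by linarith) (by linarith) (by linarith)
          nlinarith
        · push Not at h5
          have : cos (φ - θ) ≤ 0 := by
            rw [← cos_neg]
            exact cos_nonpos_of_pi_div_two_le_of_le (by linarith) (by linarith [hφ.1])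
          linarith
    have hlt : φ < θ + π / 2 := by
      by_contra! h
      have : cos (φ - θ) ≤ 0 :=
        cos_nonpos_of_pi_div_two_le_of_le (by linarith) (by linarith [hφ.2])
      linarith
    refine ⟨⟨hle, hlt⟩, ?_, h2⟩
    rcases max_cases 0 (cos φ) with h | h <;> rw [h.1] <;> linarith
  · rintro ⟨⟨h1, h2⟩, h3, h4⟩
    have : cos (φ - θ) < 1 / 2 := by
      rw [← cos_pi_div_three]
      exact cos_lt_cos_of_nonneg_of_le_pi (by linarith) (by linarith) (by linarith)
    have := le_max_right 0 (cos φ)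
    refine ⟨by nlinarith, h4, by nlinarith⟩

/-- The circle around `c` is inside the circle around `u` over the angles of the lune. -/
theorem lune_polar_le {r α θ : ℝ} (hα : 0 < α) (hαr : α ≤ r)
    (hθ0 : 0 ≤ θ) (hθ : θ < π / 6) (hcos : cos (θ + π / 3) = α / (2 * r))
    {φ : ℝ} (hφ : φ ∈ Set.Ioo (θ + π / 3) (θ + π / 2)) :
    2 * r * max 0 (cos φ) ≤ 2 * α * cos (φ - θ) := by
  have hr : 0 < r := hα.trans_le hαr
  have hpi := pi_pos
  obtain ⟨h1, h2⟩ := hφ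
  have hαcos : α = 2 * r * cos (θ + π / 3) := by rw [hcos]; field_simp
  have hc : 0 ≤ cos (φ - θ) := cos_nonneg_of_neg_pi_div_two_le_of_le (by linarith) (by linarith)
  rcases max_cases 0 (cos φ) with h | h
  · rw [h.1]
    nlinarith
  · rw [h.1]
    have hφ2 : φ < π / 2 := by
      by_contra! h'
      linarith [cos_nonpos_of_pi_div_two_le_of_le h' (by linarith : φ ≤ π + π / 2)]
    have hs : sin (θ + π / 3) ≤ sin φ :=
      sin_le_sin_of_le_of_le_pi_div_two (by linarith) hφ2.le h1.le
    have hcφ : cos φ ≤ cos (θ + π / 3) :=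
      cos_le_cos_of_nonneg_of_le_pi (by linarith) (by linarith) h1.le
    have hsθ : 0 ≤ sin θ := sin_nonneg_of_nonneg_of_le_pi hθ0 (by linarith)
    have key : (r - α * cos θ) * cos (θ + π / 3) = α * sin θ * sin (θ + π / 3) := by
      have : cos (θ + π / 3) * cos θ + sin (θ + π / 3) * sin θ = 1 / 2 := by
        rw [← cos_sub, ← cos_pi_div_three]; ring_nf
      linear_combination (-1 / 2 : ℝ) * hαcos - α * this
    have hcθ : 0 ≤ r - α * cos θ := by nlinarith [cos_le_one θ]
    have e1 := mul_le_mul_of_nonneg_left hcφ hcθ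
    have e2 := mul_le_mul_of_nonneg_left hs (mul_nonneg hα.le hsθ)
    rw [cos_sub]
    nlinarith

theorem integral_lune_polar {r α θ : ℝ} (hα : 0 < α) (hαr : α ≤ r)
    (hθ0 : 0 ≤ θ) (hθ : θ < π / 6) (hcos : θ + π / 3 = arccos (α / (2 * r))) :
    ∫ φ in (θ + π / 3)..(θ + π / 2),
      ((2 * α * cos (φ - θ)) ^ 2 - (2 * r * max 0 (cos φ)) ^ 2) / 2 =
      α ^ 2 / 2 * (π / 3 - √3 / 2) - r ^ 2 * arcsin (α / (2 * r))
        + r * α / 2 * √(1 - α ^ 2 / (4 * r ^ 2)) := by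
  have hr : 0 < r := hα.trans_le hαr
  have hpi := pi_pos
  have hint1 : ∫ φ in (θ + π / 3)..(θ + π / 2), cos (φ - θ) ^ 2 = π / 12 - √3 / 8 := by
    rw [intervalIntegral.integral_comp_sub_right (fun x => cos x ^ 2) θ, integral_cos_sq]
    simp only [add_sub_cancel_left, cos_pi_div_two, cos_pi_div_three, sin_pi_div_three]
    ring
  have hcont : Continuous fun φ : ℝ => max 0 (cos φ) ^ 2 := by fun_prop
  have hint2 : ∫ φ in (θ + π / 3)..(θ + π / 2), max 0 (cos φ) ^ 2 =
      (arcsin (α / (2 * r)) - α / (2 * r) * √(1 - (α / (2 * r)) ^ 2)) / 2 := by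
    rw [← intervalIntegral.integral_add_adjacent_intervals (b := π / 2)
      (hcont.intervalIntegrable _ _) (hcont.intervalIntegrable _ _)]
    have e1 : ∫ φ in (θ + π / 3)..(π / 2), max 0 (cos φ) ^ 2 =
        ∫ φ in (θ + π / 3)..(π / 2), cos φ ^ 2 := by
      refine intervalIntegral.integral_congr fun φ hφ => ?_
      rw [Set.uIcc_of_le (by linarith)] at hφ
      rw [max_eq_right (cos_nonneg_of_neg_pi_div_two_le_of_le (by linarith [hφ.1]) hφ.2)]
    have e2 : ∫ φ in (π / 2)..(θ + π / 2), max 0 (cos φ) ^ 2 =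
        ∫ φ in (π / 2)..(θ + π / 2), (0 : ℝ) := by
      refine intervalIntegral.integral_congr fun φ hφ => ?_
      rw [Set.uIcc_of_le (by linarith)] at hφ
      rw [max_eq_left (cos_nonpos_of_pi_div_two_le_of_le hφ.1 (by linarith [hφ.2]))]
      simp
    have hq0 : 0 < α / (2 * r) := by positivity
    have hq1 : α / (2 * r) ≤ 1 := by rw [div_le_one (by positivity)]; linarith
    rw [e1, e2, integral_cos_sq, intervalIntegral.integral_zero, hcos, cos_arccos (by linarith) hq1,
      sin_arccos, cos_pi_div_two, arccos_eq_pi_div_two_sub_arcsin]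
    ring
  have hsq : (α / (2 * r)) ^ 2 = α ^ 2 / (4 * r ^ 2) := by ring
  calc _ = ∫ φ in (θ + π / 3)..(θ + π / 2),
        (2 * α ^ 2 * cos (φ - θ) ^ 2 - 2 * r ^ 2 * max 0 (cos φ) ^ 2) := by
        congr 1; ext φ; ring
    _ = _ := by
      rw [intervalIntegral.integral_sub, intervalIntegral.integral_const_mul,
        intervalIntegral.integral_const_mul, hint1, hint2, hsq]
      · field_simp
        ring
      · exact Continuous.intervalIntegrable (by fun_prop) _ _
      · exact (hcont.const_mul _).intervalIntegrable _ _

/-- The paper's closed-form evaluation of the lune area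
`|L(α, r, arccos(α/(2r)) − π/3)|` where the lune is
`(D(v,α) ∩ D(u,α)) \ D(c,r)`, with `dist v c = r`, `dist v u = α`, and the angle
at `v` between `c` and `u` equal to `θ₀ = arccos(α/(2r)) − π/3`. -/
theorem area_lune_at_special_angle (r α : ℝ) (hr : 0 < r) (hα : 0 < α) (hαr : α ≤ r)
    (v c u : EuclideanSpace ℝ (Fin 2))
    (hvc : dist v c = r) (hvu : dist v u = α)
    (hangle : EuclideanGeometry.angle c v u = Real.arccos (α / (2 * r)) - Real.pi / 3) :
    volume ((ball v α ∩ ball u α) \ ball c r) =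
      ENNReal.ofReal
        (α ^ 2 / 2 * (Real.pi / 3 - Real.sqrt 3 / 2)
          - r ^ 2 * Real.arcsin (α / (2 * r))
          + r * α / 2 * Real.sqrt (1 - α ^ 2 / (4 * r ^ 2))) := by
  have hpi := pi_pos
  have hq0 : 0 < α / (2 * r) := by positivity
  have hq1 : α / (2 * r) ≤ 1 := by rw [div_le_one (by positivity)]; linarith
  set θ := arccos (α / (2 * r)) - π / 3 with hθdef
  have hθ0 : 0 ≤ θ := hangle ▸ InnerProductGeometry.angle_nonneg _ _
  have hθ : θ < π / 6 := by
    have := arccos_lt_pi_div_two.mpr hq0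
    linarith
  have harc : θ + π / 3 = arccos (α / (2 * r)) := by rw [hθdef]; ring
  clear_value θ
  have hcos : cos (θ + π / 3) = α / (2 * r) := by rw [harc, cos_arccos (by linarith) hq1]
  have hnc : ‖c - v‖ = r := by rw [← dist_eq_norm, dist_comm, hvc]
  have hnu : ‖u - v‖ = α := by rw [← dist_eq_norm, dist_comm, hvu]
  obtain ⟨b, hb0, hb1⟩ := exists_orthonormalBasis_adapted (r⁻¹ • (c - v)) (u - v)
    (by rw [norm_smul, hnc, norm_of_nonneg (by positivity), inv_mul_cancel₀ hr.ne'])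
  have hcv : c - v = r • b 0 := by rw [hb0, smul_inv_smul₀ hr.ne']
  have hc0 : b.repr (c - v) 0 = r := by simp [hcv]
  have hc1 : b.repr (c - v) 1 = 0 := by simp [hcv]
  have hu0 : b.repr (u - v) 0 = α * cos θ := by
    have h := InnerProductGeometry.cos_angle_mul_norm_mul_norm (c - v) (u - v)
    have ha : InnerProductGeometry.angle (c - v) (u - v) = θ := hangle
    rw [ha, hnc, hnu] at h
    rw [OrthonormalBasis.repr_apply_apply, hb0, real_inner_smul_left, ← h]
    field_simp
  have hnorm : ∀ x : EuclideanSpace ℝ (Fin 2), ‖x‖ ^ 2 = b.repr x 0 ^ 2 + b.repr x 1 ^ 2 := by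
    intro x
    rw [← b.repr.norm_map, EuclideanSpace.norm_sq_eq, Fin.sum_univ_two]
    simp
  have hu1 : b.repr (u - v) 1 = α * sin θ := by
    have h := hnorm (u - v)
    rw [hnu, hu0] at h
    have hs : 0 ≤ sin θ := sin_nonneg_of_nonneg_of_le_pi hθ0 (by linarith)
    refine (sq_eq_sq₀ hb1 (by positivity)).mp ?_
    linear_combination -h - α ^ 2 * sin_sq_add_cos_sq θ
  let F : EuclideanSpace ℝ (Fin 2) → ℝ × ℝ := fun x => (b.repr (x - v) 0, b.repr (x - v) 1)
  have hF : MeasurePreserving F :=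
    (volume_preserving_finTwoArrow ℝ).comp ((PiLp.volume_preserving_ofLp (Fin 2)).comp
      (b.measurePreserving_repr.comp (measurePreserving_sub_right volume v)))
  let S : Set (ℝ × ℝ) := {p | p.1 ^ 2 + p.2 ^ 2 < α ^ 2} ∩
    ({p | (p.1 - α * cos θ) ^ 2 + (p.2 - α * sin θ) ^ 2 < α ^ 2} ∩
      {p | r ^ 2 ≤ (p.1 - r) ^ 2 + p.2 ^ 2})
  have hS : MeasurableSet S := by
    refine (measurableSet_lt ?_ ?_).inter
      (MeasurableSet.inter (measurableSet_lt ?_ ?_) (measurableSet_le ?_ ?_)) <;> fun_prop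
  have hpre : (ball v α ∩ ball u α) \ ball c r = F ⁻¹' S := by
    ext x
    have hxu : x - u = (x - v) - (u - v) := by abel
    have hxc : x - c = (x - v) - (c - v) := by abel
    simp only [Set.mem_sdiff, Set.mem_inter_iff, mem_ball, dist_eq_norm, Set.mem_preimage, S, F,
      Set.mem_ofPred_eq, not_lt, and_assoc]
    rw [← sq_lt_sq₀ (norm_nonneg (x - v)) hα.le, ← sq_lt_sq₀ (norm_nonneg (x - u)) hα.le,
      ← sq_le_sq₀ hr.le (norm_nonneg (x - c)), hxu, hxc, hnorm, hnorm (_ - (u - v)),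
      hnorm (_ - (c - v)), map_sub b.repr (x - v), map_sub b.repr (x - v)]
    simp only [PiLp.sub_apply, hu0, hu1, hc0, hc1, sub_zero]
  rw [hpre, hF.measure_preimage hS.nullMeasurableSet,
    ← integral_lune_polar hα hαr hθ0 hθ harc]
  refine volume_eq_ofReal_integral_of_polar hS (by fun_prop) (by fun_prop) (by linarith)
    (by linarith) (by linarith) (fun φ _ => by positivity)
    (fun φ hφ => lune_polar_le hα hαr hθ0 hθ hcos hφ) fun ρ φ hρ hφ => ?_
  rw [← lune_polar_iff hα hαr hθ0 hθ hcos hρ hφ]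
  have t1 : (ρ * cos φ) ^ 2 + (ρ * sin φ) ^ 2 = ρ ^ 2 := by
    linear_combination ρ ^ 2 * sin_sq_add_cos_sq φ
  have t2 : (ρ * cos φ - α * cos θ) ^ 2 + (ρ * sin φ - α * sin θ) ^ 2 =
      α ^ 2 + ρ * (ρ - 2 * α * cos (φ - θ)) := by
    rw [cos_sub]
    linear_combination ρ ^ 2 * sin_sq_add_cos_sq φ + α ^ 2 * sin_sq_add_cos_sq θ
  have t3 : (ρ * cos φ - r) ^ 2 + (ρ * sin φ) ^ 2 = r ^ 2 + ρ * (ρ - 2 * r * cos φ) := by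
    linear_combination ρ ^ 2 * sin_sq_add_cos_sq φ
  simp only [S, Set.mem_inter_iff, Set.mem_ofPred_eq, t1, t2, t3]
  refine and_congr (sq_lt_sq₀ hρ.le hα.le) (and_congr ?_ ?_)
  · rw [add_lt_iff_neg_left, ← sub_neg (a := ρ)]
    exact ⟨(pos_iff_neg_of_mul_neg · |>.mp hρ), mul_neg_of_pos_of_neg hρ⟩
  · rw [le_add_iff_nonneg_right, mul_nonneg_iff_of_pos_left hρ, sub_nonneg]
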